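/- Suppose k ≥ 2 and S is an optimal assignment map. Let j ∈ {1,…,ℓ} and s ∈ {1,…,k}. If for every i ≠ s with m(b_i) ≥ n_j one has ‖y_j − x_s‖ < ρ_α(m(b_i), n_j)·‖y_j − x_i‖, then S(j) = s. -/

import Mathlib

open scoped BigOperators RealInnerProductSpace

noncomputable section

attribute [local instance] Classical.propDecidable

/-- Points of the ambient Euclidean space `ℝ^m`. -/
abbrev Pt (m : ℕ) := EuclideanSpace ℝ (Fin m)

/-- A weighted directed graph in `ℝ^m`: a finite vertex set, a finite set of
directed edges (ordered pairs of points, viewed as directed line segments), and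
a weight function. -/
structure WDG (m : ℕ) where
  V : Finset (Pt m)
  E : Finset (Pt m × Pt m)
  w : Pt m × Pt m → ℝ

namespace WDG

variable {m : ℕ}

/-- Edges join distinct vertices of the graph and carry positive weight. -/
def edgesOK (G : WDG m) : Prop :=
  ∀ e ∈ G.E, e.1 ∈ G.V ∧ e.2 ∈ G.V ∧ e.1 ≠ e.2 ∧ 0 < G.w e

/-- The underlying undirected (simple) graph. -/
def undirected (G : WDG m) : SimpleGraph (Pt m) :=
  SimpleGraph.fromRel (fun u v => (u, v) ∈ G.E)

/-- The cost `M_α(G) = Σ_{e ∈ E(G)} w(e)^α · length(e)`. -/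
def cost (α : ℝ) (G : WDG m) : ℝ :=
  ∑ e ∈ G.E, (G.w e) ^ α * dist e.1 e.2

/-- Total weight of edges starting at `v`. -/
def outflow (G : WDG m) (v : Pt m) : ℝ :=
  ∑ e ∈ G.E.filter (fun e => e.1 = v), G.w e

/-- Total weight of edges ending at `v`. -/
def inflow (G : WDG m) (v : Pt m) : ℝ :=
  ∑ e ∈ G.E.filter (fun e => e.2 = v), G.w e

end WDG

/-- Atomic measures are represented as finitely supported functions `ℝ^m →₀ ℝ`
with nonnegative values; `AtomicOn X c` also requires the atoms to lie in `X`. -/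
def AtomicOn {m : ℕ} (X : Set (Pt m)) (c : Pt m →₀ ℝ) : Prop :=
  (∀ z, 0 ≤ c z) ∧ ↑c.support ⊆ X

/-- The mass `m(c)` of an atomic measure. -/
def massOf {m : ℕ} (c : Pt m →₀ ℝ) : ℝ := c.sum fun _ t => t

/-- `G` is a transport path from `a` to `b` inside `X`: its vertices lie in `X`
and contain the atoms of `a` and `b`, its underlying undirected graph has no
cycles, and the balance equation holds at every vertex. -/
def IsTransportPath {m : ℕ} (X : Set (Pt m)) (G : WDG m) (a b : Pt m →₀ ℝ) : Prop :=
  G.edgesOK ∧ ↑G.V ⊆ X ∧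
  (∀ z ∈ a.support, z ∈ G.V) ∧ (∀ z ∈ b.support, z ∈ G.V) ∧
  G.undirected.IsAcyclic ∧
  ∀ v : Pt m, G.outflow v - G.inflow v = a v - b v

/-- `d_α(a,b)`: the minimal cost of a transport path from `a` to `b`. -/
def dCost {m : ℕ} (X : Set (Pt m)) (α : ℝ) (a b : Pt m →₀ ℝ) : ℝ :=
  sInf (WDG.cost α '' {G : WDG m | IsTransportPath X G a b})

/-- An optimal transport path from `a` to `b`. -/
def IsOptimalTP {m : ℕ} (X : Set (Pt m)) (α : ℝ) (G : WDG m) (a b : Pt m →₀ ℝ) : Prop :=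
  IsTransportPath X G a b ∧
    ∀ G' : WDG m, IsTransportPath X G' a b → WDG.cost α G ≤ WDG.cost α G'

/-- The atomic probability measure `b = Σ_j n_j δ_{y_j}` of households. -/
def bMeas {m ℓ : ℕ} (y : Fin ℓ → Pt m) (n : Fin ℓ → ℝ) : Pt m →₀ ℝ :=
  ∑ j, Finsupp.single (y j) (n j)

/-- An allocation path from the factory locations `x` to the households `(y,n)`:
a transport path to `b` from some atomic probability measure supported on the
factory locations. -/
def IsAllocPath {m k ℓ : ℕ} (X : Set (Pt m)) (x : Fin k → Pt m)
    (y : Fin ℓ → Pt m) (n : Fin ℓ → ℝ) (G : WDG m) : Prop :=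
  ∃ a : Pt m →₀ ℝ, (∀ z, 0 ≤ a z) ∧ ↑a.support ⊆ Set.range x ∧ massOf a = 1 ∧
    IsTransportPath X G a (bMeas y n)

/-- An optimal allocation path: it minimizes `M_α` over all allocation paths. -/
def IsOptimalAllocPath {m k ℓ : ℕ} (X : Set (Pt m)) (α : ℝ) (x : Fin k → Pt m)
    (y : Fin ℓ → Pt m) (n : Fin ℓ → ℝ) (G : WDG m) : Prop :=
  IsAllocPath X x y n G ∧
    ∀ G' : WDG m, IsAllocPath X x y n G' → WDG.cost α G ≤ WDG.cost α G'

/-- For an assignment map `S`, the part `b_i = Σ_{j : S(j) = i} n_j δ_{y_j}`. -/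
def bPart {m k ℓ : ℕ} (y : Fin ℓ → Pt m) (n : Fin ℓ → ℝ) (S : Fin ℓ → Fin k)
    (i : Fin k) : Pt m →₀ ℝ :=
  ∑ j ∈ Finset.univ.filter (fun j => S j = i), Finsupp.single (y j) (n j)

/-- The mass `m(b_i) = Σ_{j : S(j) = i} n_j`. -/
def mB {k ℓ : ℕ} (n : Fin ℓ → ℝ) (S : Fin ℓ → Fin k) (i : Fin k) : ℝ :=
  ∑ j ∈ Finset.univ.filter (fun j => S j = i), n j

/-- `E_α(S) = Σ_i d_α(m(b_i) δ_{x_i}, b_i)`. -/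
def Ealpha {m k ℓ : ℕ} (X : Set (Pt m)) (α : ℝ) (x : Fin k → Pt m)
    (y : Fin ℓ → Pt m) (n : Fin ℓ → ℝ) (S : Fin ℓ → Fin k) : ℝ :=
  ∑ i, dCost X α (Finsupp.single (x i) (mB n S i)) (bPart y n S i)

/-- An optimal assignment map minimizes `E_α` over all assignment maps. -/
def IsOptimalAssign {m k ℓ : ℕ} (X : Set (Pt m)) (α : ℝ) (x : Fin k → Pt m)
    (y : Fin ℓ → Pt m) (n : Fin ℓ → ℝ) (S : Fin ℓ → Fin k) : Prop :=
  ∀ S' : Fin ℓ → Fin k, Ealpha X α x y n S ≤ Ealpha X α x y n S'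

/-- `ρ_α(σ,ε)`: equals `(σ/ε)^α − (σ/ε − 1)^α` for `σ > ε` (and for `σ = ε` when
`α ∈ (0,1)`), and equals `1` when `σ = ε` (covering also the convention for `α = 0`). -/
def rho (α σ ε : ℝ) : ℝ :=
  if σ = ε then 1 else (σ / ε) ^ α - (σ / ε - 1) ^ α


/-- `G` is the disjoint union of the subgraphs `Gi`: the `Gi` have pairwise
disjoint vertex sets, each is a subgraph of `G` (with matching weights), and
the edges of `G` are exactly the (disjoint) union of their edges. -/
def IsDisjointUnion {m k : ℕ} (G : WDG m) (Gi : Fin k → WDG m) : Prop :=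
  (∀ i i' : Fin k, i ≠ i' → Disjoint (Gi i).V (Gi i').V) ∧
  (∀ i, (Gi i).V ⊆ G.V) ∧
  (∀ i, (Gi i).E ⊆ G.E) ∧
  (∀ i, ∀ e ∈ (Gi i).E, (Gi i).w e = G.w e) ∧
  G.E = Finset.univ.biUnion (fun i => (Gi i).E)

/-- The projection coordinate `π(z) = ⟨z − p, v⟩` along the line through `p`
in direction `v`. -/
def proj {m : ℕ} (p v z : Pt m) : ℝ := ⟪z - p, v⟫

/-- The constant `C = √(m−1)/(2^{1−(m−1)(1−α)} − 1) + 1`. -/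
def Cconst (m : ℕ) (α : ℝ) : ℝ :=
  Real.sqrt ((m : ℝ) - 1) / ((2 : ℝ) ^ (1 - ((m : ℝ) - 1) * (1 - α)) - 1) + 1


/-- The cost per unit length `t^α` of a net flow `t > 0`, extended by `0` to `t ≤ 0`. -/
def unitCost (α t : ℝ) : ℝ := if t ≤ 0 then 0 else t ^ α

lemma unitCost_of_nonpos {α t : ℝ} (ht : t ≤ 0) : unitCost α t = 0 := if_pos ht

lemma unitCost_of_pos {α t : ℝ} (ht : 0 < t) : unitCost α t = t ^ α := if_neg ht.not_ge

lemma unitCost_nonneg (α t : ℝ) : 0 ≤ unitCost α t := by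
  unfold unitCost
  split_ifs with h
  · exact le_rfl
  · exact Real.rpow_nonneg (not_le.1 h).le _

lemma unitCost_mono {α : ℝ} (hα : 0 ≤ α) : Monotone (unitCost α) := by
  intro s t hst
  rcases le_or_gt s 0 with hs | hs
  · rw [unitCost_of_nonpos hs]
    exact unitCost_nonneg _ _
  · rw [unitCost_of_pos hs, unitCost_of_pos (hs.trans_le hst)]
    exact Real.rpow_le_rpow hs.le hst hα

lemma concaveOn_unitCost {α : ℝ} (hα0 : 0 ≤ α) (hα1 : α ≤ 1) :
    ConcaveOn ℝ (Set.Ici 0) (unitCost α) := by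
  rcases hα0.eq_or_lt with rfl | hα
  · refine ⟨convex_Ici 0, fun s hs t ht p q hp hq hpq => ?_⟩
    have hval : ∀ r : ℝ, unitCost 0 r ≤ 1 := fun r => by
      unfold unitCost
      split_ifs <;> simp
    simp only [smul_eq_mul, Set.mem_Ici] at *
    rcases le_or_gt (p * s + q * t) 0 with h | h
    · have h1 : p * s = 0 := by nlinarith [mul_nonneg hp hs, mul_nonneg hq ht]
      have h2 : q * t = 0 := by nlinarith [mul_nonneg hp hs, mul_nonneg hq ht]
      rw [unitCost_of_nonpos h]
      rcases mul_eq_zero.1 h1 with h1 | h1 <;> rcases mul_eq_zero.1 h2 with h2 | h2 <;>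
        simp [h1, h2, unitCost]
    · rw [unitCost_of_pos h, Real.rpow_zero]
      nlinarith [hval s, hval t, mul_le_mul_of_nonneg_left (hval s) hp,
        mul_le_mul_of_nonneg_left (hval t) hq]
  · refine (Real.concaveOn_rpow hα0 hα1).congr fun t ht => ?_
    rcases (Set.mem_Ici.1 ht).eq_or_lt with rfl | h
    · simp [unitCost, hα.ne']
    · exact (unitCost_of_pos h).symm

/-- Decreasing increments of the concave function `unitCost α`. -/
lemma unitCost_increment_le {α r t ε : ℝ} (hα0 : 0 ≤ α) (hα1 : α ≤ 1) (hr : 0 ≤ r)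
    (hrt : r ≤ t) (hε : 0 < ε) :
    unitCost α (t + ε) + unitCost α r ≤ unitCost α (r + ε) + unitCost α t := by
  have hc := concaveOn_unitCost hα0 hα1
  have hd : 0 < t - r + ε := by linarith
  set p := (t - r) / (t - r + ε) with hp
  set q := ε / (t - r + ε) with hq
  have hp0 : 0 ≤ p := div_nonneg (by linarith) hd.le
  have hq0 : 0 ≤ q := div_nonneg hε.le hd.le
  have hpq : p + q = 1 := by rw [hp, hq]; field_simp
  have hT : t + ε ∈ Set.Ici (0 : ℝ) := by simp only [Set.mem_Ici]; linarith
  have h1 := hc.2 hT (Set.mem_Ici.2 hr) hp0 hq0 hpq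
  have h2 := hc.2 hT (Set.mem_Ici.2 hr) hq0 hp0 (by linarith)
  have e1 : p * (t + ε) + q * r = t := by rw [hp, hq]; field_simp; ring
  have e2 : q * (t + ε) + p * r = r + ε := by rw [hp, hq]; field_simp; ring
  simp only [smul_eq_mul] at h1 h2
  rw [e1] at h1
  rw [e2] at h2
  have e3 : (p + q) * (unitCost α (t + ε) + unitCost α r)
      = unitCost α (t + ε) + unitCost α r := by rw [hpq, one_mul]
  linarith

lemma unitCost_add_le {α : ℝ} (hα0 : 0 ≤ α) (hα1 : α ≤ 1) (s t : ℝ) :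
    unitCost α (s + t) ≤ unitCost α s + unitCost α t := by
  rcases le_or_gt s 0 with hs | hs
  · rw [unitCost_of_nonpos hs, zero_add]
    exact unitCost_mono hα0 (by linarith)
  rcases le_or_gt t 0 with ht | ht
  · rw [unitCost_of_nonpos ht, add_zero]
    exact unitCost_mono hα0 (by linarith)
  have h := unitCost_increment_le (r := 0) hα0 hα1 le_rfl hs.le ht
  rw [unitCost_of_nonpos le_rfl, zero_add] at h
  linarith

lemma rpow_mul_rho {α M ε : ℝ} (hM : 0 ≤ M) (hε : 0 < ε) :
    ε ^ α * rho α (M + ε) ε = unitCost α (M + ε) - unitCost α M := by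
  rw [unitCost_of_pos (by linarith : 0 < M + ε)]
  rcases hM.eq_or_lt with rfl | hM
  · simp [rho, unitCost_of_nonpos]
  · have hne : M + ε ≠ ε := by linarith
    have hsub : (M + ε) / ε - 1 = M / ε := by field_simp; ring
    rw [rho, if_neg hne, hsub, unitCost_of_pos hM, mul_sub, ← Real.mul_rpow hε.le (by positivity),
      ← Real.mul_rpow hε.le (by positivity), mul_div_cancel₀ _ hε.ne', mul_div_cancel₀ _ hε.ne']

section NetFlow

variable {m : ℕ}

/-- A net flow on the finite vertex set `V`: `f u v` is the flow from `u` to `v` minus the flow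
from `v` to `u`. -/
structure IsFlow (V : Finset (Pt m)) (f : Pt m → Pt m → ℝ) : Prop where
  anti : ∀ u v, f v u = -f u v
  supp : ∀ u v, f u v ≠ 0 → u ∈ V

/-- Net flow out of the vertex `u`. -/
def flowDiv (V : Finset (Pt m)) (f : Pt m → Pt m → ℝ) (u : Pt m) : ℝ := ∑ v ∈ V, f u v

/-- The `α`-cost of a net flow. -/
def flowCost (α : ℝ) (V : Finset (Pt m)) (f : Pt m → Pt m → ℝ) : ℝ :=
  ∑ u ∈ V, ∑ v ∈ V, unitCost α (f u v) * dist u v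

/-- The undirected support of a net flow. -/
def flowGraph (f : Pt m → Pt m → ℝ) : SimpleGraph (Pt m) :=
  SimpleGraph.fromRel fun u v => f u v ≠ 0

/-- The net flow sending one unit from `a` to `b` along the segment joining them. -/
def segFlow (a b u v : Pt m) : ℝ :=
  (if u = a ∧ v = b then 1 else 0) - (if v = a ∧ u = b then 1 else 0)

namespace IsFlow

variable {V : Finset (Pt m)} {f g : Pt m → Pt m → ℝ}

lemma self (hf : IsFlow V f) (u : Pt m) : f u u = 0 := by
  linarith [hf.anti u u]

lemma right_mem (hf : IsFlow V f) {u v : Pt m} (h : f u v ≠ 0) : v ∈ V :=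
  hf.supp v u (by rw [hf.anti]; exact neg_ne_zero.2 h)

lemma adj_iff (hf : IsFlow V f) {u v : Pt m} : (flowGraph f).Adj u v ↔ f u v ≠ 0 := by
  rw [flowGraph, SimpleGraph.fromRel_adj, hf.anti u v, neg_ne_zero, or_self]
  exact ⟨fun h => h.2, fun h => ⟨fun e => h (by rw [e, hf.self]), h⟩⟩

lemma add_smul (hf : IsFlow V f) (hg : IsFlow V g) (t : ℝ) :
    IsFlow V fun u v => f u v + t * g u v where
  anti u v := by rw [hf.anti, hg.anti]; ring
  supp u v h := by
    by_contra hu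
    have h1 : f u v = 0 := by_contra fun h' => hu (hf.supp u v h')
    have h2 : g u v = 0 := by_contra fun h' => hu (hg.supp u v h')
    exact h (by simp [h1, h2])

/-- The net flow out of a vertex subset only sees the edges leaving it. -/
lemma sum_flowDiv (hf : IsFlow V f) (C : Set (Pt m)) :
    ∑ u ∈ V with u ∈ C, flowDiv V f u
      = ∑ u ∈ V with u ∈ C, ∑ v ∈ V with v ∉ C, f u v := by
  have hin : ∑ u ∈ V with u ∈ C, ∑ v ∈ V with v ∈ C, f u v = 0 := by
    have h : ∑ u ∈ V with u ∈ C, ∑ v ∈ V with v ∈ C, f u v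
        = -∑ u ∈ V with u ∈ C, ∑ v ∈ V with v ∈ C, f u v := by
      conv_lhs => rw [Finset.sum_comm]
      simp only [← Finset.sum_neg_distrib]
      exact Finset.sum_congr rfl fun u _ => Finset.sum_congr rfl fun v _ => hf.anti u v
    linarith
  have hsplit : ∀ u, flowDiv V f u
      = ∑ v ∈ V with v ∈ C, f u v + ∑ v ∈ V with v ∉ C, f u v := fun u =>
    (Finset.sum_filter_add_sum_filter_not V (· ∈ C) (f u)).symm
  simp only [hsplit, Finset.sum_add_distrib, hin, zero_add]

lemma sum_flowDiv_eq_zero (hf : IsFlow V f) (C : Set (Pt m))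
    (hC : ∀ u v, u ∈ C → f u v ≠ 0 → v ∈ C) :
    ∑ u ∈ V with u ∈ C, flowDiv V f u = 0 := by
  rw [hf.sum_flowDiv]
  refine Finset.sum_eq_zero fun u hu => Finset.sum_eq_zero fun v hv => ?_
  by_contra h
  exact (Finset.mem_filter.1 hv).2 (hC u v (Finset.mem_filter.1 hu).2 h)

lemma sum_flowDiv_eq_of_cut (hf : IsFlow V f) (C : Set (Pt m)) {a b : Pt m}
    (ha : a ∈ V) (hb : b ∈ V) (haC : a ∈ C) (hbC : b ∉ C)
    (hC : ∀ u v, u ∈ C → v ∉ C → f u v ≠ 0 → u = a ∧ v = b) :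
    ∑ u ∈ V with u ∈ C, flowDiv V f u = f a b := by
  rw [hf.sum_flowDiv, Finset.sum_eq_single a, Finset.sum_eq_single b]
  · intro v hv hvb
    by_contra h
    exact hvb (hC a v haC (Finset.mem_filter.1 hv).2 h).2
  · exact fun h => absurd (Finset.mem_filter.2 ⟨hb, hbC⟩) h
  · intro u hu hua
    refine Finset.sum_eq_zero fun v hv => ?_
    by_contra h
    exact hua (hC u v (Finset.mem_filter.1 hu).2 (Finset.mem_filter.1 hv).2 h).1
  · exact fun h => absurd (Finset.mem_filter.2 ⟨ha, haC⟩) h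

end IsFlow

lemma flowDiv_add_smul (V : Finset (Pt m)) (f g : Pt m → Pt m → ℝ) (t : ℝ) (u : Pt m) :
    flowDiv V (fun u v => f u v + t * g u v) u = flowDiv V f u + t * flowDiv V g u := by
  simp [flowDiv, Finset.sum_add_distrib, Finset.mul_sum]

lemma isFlow_segFlow {V : Finset (Pt m)} {a b : Pt m} (ha : a ∈ V) (hb : b ∈ V) :
    IsFlow V (segFlow a b) where
  anti u v := by simp [segFlow]
  supp u v h := by
    by_contra hu
    have h1 : u ≠ a := fun e => hu (e ▸ ha)
    have h2 : u ≠ b := fun e => hu (e ▸ hb)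
    exact h (by simp [segFlow, h1, h2])

lemma flowDiv_segFlow {V : Finset (Pt m)} {a b : Pt m} (ha : a ∈ V) (hb : b ∈ V) (u : Pt m) :
    flowDiv V (segFlow a b) u = (if u = a then 1 else 0) - (if u = b then 1 else 0) := by
  simp only [flowDiv, segFlow, Finset.sum_sub_distrib]
  congr 1
  · by_cases h : u = a <;> simp [h, hb]
  · by_cases h : u = b <;> simp [h, ha]

/-- Joined vertices exchange a unit of flow inside the graph joining them. -/
lemma exists_unit_flow {V : Finset (Pt m)} {H : SimpleGraph (Pt m)}
    (hH : ∀ u v, H.Adj u v → u ∈ V) {a b : Pt m} (h : H.Reachable a b) :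
    ∃ z, IsFlow V z ∧ (∀ u v, z u v ≠ 0 → H.Adj u v) ∧
      ∀ u, flowDiv V z u = (if u = a then 1 else 0) - (if u = b then 1 else 0) := by
  obtain ⟨p⟩ := h
  induction p with
  | nil => exact ⟨fun _ _ => 0, ⟨by simp, by simp⟩, by simp, by simp [flowDiv]⟩
  | @cons a c b hac p ih =>
    obtain ⟨z, hz, hzH, hzd⟩ := ih
    have ha := hH _ _ hac
    have hc := hH _ _ hac.symm
    refine ⟨_, hz.add_smul (isFlow_segFlow ha hc) 1, fun u v h => ?_, fun u => ?_⟩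
    · by_cases h1 : z u v = 0
      · have h2 : segFlow a c u v ≠ 0 := fun h2 => h (by simp [h1, h2])
        by_cases h3 : u = a ∧ v = c
        · rw [h3.1, h3.2]; exact hac
        by_cases h4 : v = a ∧ u = c
        · rw [h4.1, h4.2]; exact hac.symm
        exact absurd (by simp [segFlow, h3, h4]) h2
      · exact hzH u v h1
    · rw [flowDiv_add_smul, hzd, flowDiv_segFlow ha hc]
      ring

lemma flowCost_le_add {α : ℝ} (hα0 : 0 ≤ α) (hα1 : α ≤ 1) (V : Finset (Pt m))
    (f g : Pt m → Pt m → ℝ) (t : ℝ) :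
    flowCost α V (fun u v => f u v + t * g u v)
      ≤ flowCost α V f + flowCost α V (fun u v => t * g u v) := by
  simp only [flowCost, ← Finset.sum_add_distrib, ← add_mul]
  gcongr
  exact unitCost_add_le hα0 hα1 _ _

lemma flowCost_segFlow_le {α ε : ℝ} (hε : 0 < ε) (V : Finset (Pt m)) (a b : Pt m) :
    flowCost α V (fun u v => ε * segFlow a b u v) ≤ ε ^ α * dist a b := by
  have h : ∀ u v, unitCost α (ε * segFlow a b u v) * dist u v
      ≤ if u = a then (if v = b then ε ^ α * dist a b else 0) else 0 := by
    intro u v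
    by_cases h1 : u = a ∧ v = b
    · obtain ⟨rfl, rfl⟩ := h1
      by_cases h2 : u = v
      · simp [h2]
      · simp [segFlow, Ne.symm h2, h2, unitCost_of_pos hε]
    · have h2 : unitCost α (ε * segFlow a b u v) = 0 := by
        apply unitCost_of_nonpos
        rw [segFlow, if_neg h1]
        split_ifs <;> simp [hε.le]
      rw [h2, zero_mul]
      split_ifs <;> first | exact le_rfl | positivity
  calc flowCost α V (fun u v => ε * segFlow a b u v)
      ≤ ∑ u ∈ V, ∑ v ∈ V, if u = a then (if v = b then ε ^ α * dist a b else 0) else 0 :=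
        Finset.sum_le_sum fun u _ => Finset.sum_le_sum fun v _ => h u v
    _ ≤ ε ^ α * dist a b := by
        have h0 : 0 ≤ ε ^ α * dist a b := by positivity
        have h1 : ∀ u, (∑ v ∈ V, if u = a then (if v = b then ε ^ α * dist a b else 0) else 0)
            = if u = a then (if b ∈ V then ε ^ α * dist a b else 0) else 0 := by
          intro u
          by_cases h : u = a <;> simp [h]
        simp only [h1, Finset.sum_ite_eq']
        split_ifs <;> first | exact le_rfl | exact h0

/-- The total length of a unit flow from `a` to `b` is at least the distance of `a` and `b`. -/
lemma dist_le_sum_of_unit_flow {V : Finset (Pt m)} {z : Pt m → Pt m → ℝ} (hz : IsFlow V z)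
    {a b : Pt m} (ha : a ∈ V) (hb : b ∈ V)
    (hd : ∀ u, flowDiv V z u = (if u = a then 1 else 0) - (if u = b then 1 else 0)) :
    dist a b ≤ ∑ u ∈ V, ∑ v ∈ V, max (z u v) 0 * dist u v := by
  have hpair : ∑ u ∈ V, ∑ v ∈ V, max (z u v) 0 * (dist u b - dist v b) = dist a b := by
    have h1 : ∑ u ∈ V, ∑ v ∈ V, max (z u v) 0 * dist v b
        = ∑ u ∈ V, ∑ v ∈ V, max (-z u v) 0 * dist u b := by
      rw [Finset.sum_comm]
      refine Finset.sum_congr rfl fun u _ => Finset.sum_congr rfl fun v _ => ?_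
      rw [hz.anti u v]
    simp only [mul_sub, Finset.sum_sub_distrib, h1]
    simp only [← Finset.sum_sub_distrib, ← sub_mul, max_zero_sub_max_neg_zero_eq_self,
      ← Finset.sum_mul]
    have h2 : ∀ u, ∑ v ∈ V, z u v = (if u = a then 1 else 0) - (if u = b then 1 else 0) := hd
    simp [h2, sub_mul, Finset.sum_sub_distrib, ha, hb]
  rw [← hpair]
  gcongr with u _ v _
  linarith [dist_triangle u v b]

/-- Moving `f` against `z` until the first edge carrying both with the same sign vanishes. -/
lemma exists_cancel {V : Finset (Pt m)} {f z : Pt m → Pt m → ℝ} (hf : IsFlow V f)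
    (hpos : ∃ u v, 0 < f u v ∧ 0 < z u v) :
    ∃ t > 0, (∀ u v, 0 < f u v → 0 ≤ f u v + -t * z u v) ∧
      ∃ u v, f u v ≠ 0 ∧ f u v + -t * z u v = 0 := by
  obtain ⟨u₀, v₀, hf₀, hz₀⟩ := hpos
  let T : Finset (Pt m × Pt m) := (V ×ˢ V).filter fun e => 0 < f e.1 e.2 ∧ 0 < z e.1 e.2
  have hT : ∀ u v, 0 < f u v → 0 < z u v → (u, v) ∈ T := fun u v h1 h2 =>
    Finset.mem_filter.2 ⟨Finset.mem_product.2 ⟨hf.supp u v h1.ne', hf.right_mem h1.ne'⟩, h1, h2⟩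
  obtain ⟨e, he, hmin⟩ := T.exists_min_image (fun e => f e.1 e.2 / z e.1 e.2)
    ⟨_, hT u₀ v₀ hf₀ hz₀⟩
  obtain ⟨-, hfe, hze⟩ := Finset.mem_filter.1 he
  refine ⟨f e.1 e.2 / z e.1 e.2, div_pos hfe hze, fun u v huv => ?_, e.1, e.2, hfe.ne', ?_⟩
  · have ht := div_pos hfe hze
    rcases le_or_gt (z u v) 0 with h | h
    · nlinarith
    · have h1 := (le_div_iff₀ h).1 (hmin _ (hT u v huv h))
      linarith
  · field_simp
    ring

/-- The set of edges, in both directions, carrying flow. -/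
def flowSupport (V : Finset (Pt m)) (f : Pt m → Pt m → ℝ) : Finset (Pt m × Pt m) :=
  (V ×ˢ V).filter fun e => f e.1 e.2 ≠ 0

lemma card_flowSupport_lt {V : Finset (Pt m)} {f g : Pt m → Pt m → ℝ} (hf : IsFlow V f)
    (hfg : ∀ u v, f u v = 0 → g u v = 0) (h : ∃ u v, f u v ≠ 0 ∧ g u v = 0) :
    (flowSupport V g).card < (flowSupport V f).card := by
  obtain ⟨u, v, hu, hv⟩ := h
  refine Finset.card_lt_card (Finset.ssubset_iff_of_subset ?_ |>.2 ⟨(u, v), ?_, ?_⟩)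
  · exact Finset.monotone_filter_right _ fun e _ he h0 => he (hfg _ _ h0)
  · exact Finset.mem_filter.2 ⟨Finset.mem_product.2 ⟨hf.supp u v hu, hf.right_mem hu⟩, hu⟩
  · exact fun h' => (Finset.mem_filter.1 h').2 hv

/-- Cycle reduction: a circulation in the support of `f` allows one to remove an edge from the
support without increasing the cost. -/
lemma exists_smaller_support_of_pos {α : ℝ} (hα0 : 0 ≤ α) (hα1 : α ≤ 1) {V : Finset (Pt m)}
    {f z : Pt m → Pt m → ℝ} (hf : IsFlow V f) (hz : IsFlow V z)
    (hzf : ∀ u v, f u v = 0 → z u v = 0) (hpos : ∃ u v, 0 < f u v ∧ 0 < z u v) :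
    ∃ t : ℝ, flowCost α V (fun u v => f u v + t * z u v) ≤ flowCost α V f ∧
      (flowSupport V fun u v => f u v + t * z u v).card < (flowSupport V f).card := by
  have hcard : ∀ t : ℝ, (∃ u v, f u v ≠ 0 ∧ f u v + t * z u v = 0) →
      (flowSupport V fun u v => f u v + t * z u v).card < (flowSupport V f).card := fun t ht =>
    card_flowSupport_lt hf (fun u v h => by rw [h, hzf u v h]; ring) ht
  obtain ⟨t₁, ht₁, hs₁, hv₁⟩ := exists_cancel hf hpos
  have hneg : ∀ t : ℝ, (∀ u v, 0 < f u v → 0 ≤ f u v + t * z u v) →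
      ∀ u v, f u v ≤ 0 → f u v + t * z u v ≤ 0 := by
    intro t ht u v huv
    rcases huv.eq_or_lt with h | h
    · rw [h, hzf u v h]; simp
    · have := ht v u (by rw [hf.anti u v]; linarith)
      rw [hf.anti u v, hz.anti u v] at this
      linarith
  by_cases hopp : ∃ u v, 0 < f u v ∧ z u v < 0
  · obtain ⟨t₂, ht₂, hs₂, hv₂⟩ := exists_cancel (z := fun u v => -z u v) hf (by simpa using hopp)
    simp only [neg_mul_neg] at hs₂ hv₂
    have hsum : t₂ * flowCost α V (fun u v => f u v + -t₁ * z u v)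
        + t₁ * flowCost α V (fun u v => f u v + t₂ * z u v) ≤ (t₁ + t₂) * flowCost α V f := by
      simp only [flowCost, Finset.mul_sum, ← Finset.sum_add_distrib, ← mul_assoc, ← add_mul]
      gcongr with u _ v _
      rcases le_or_gt (f u v) 0 with h | h
      · rw [unitCost_of_nonpos h, unitCost_of_nonpos (hneg _ hs₁ u v h),
          unitCost_of_nonpos (hneg _ hs₂ u v h)]
        simp
      · have hc := (concaveOn_unitCost hα0 hα1).2 (Set.mem_Ici.2 (hs₁ u v h))
          (Set.mem_Ici.2 (hs₂ u v h)) (by positivity : 0 ≤ t₂ / (t₁ + t₂))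
          (by positivity : 0 ≤ t₁ / (t₁ + t₂)) (by field_simp; ring)
        simp only [smul_eq_mul] at hc
        have he : t₂ / (t₁ + t₂) * (f u v + -t₁ * z u v) + t₁ / (t₁ + t₂) * (f u v + t₂ * z u v)
            = f u v := by field_simp; ring
        rw [he] at hc
        have hd : 0 < t₁ + t₂ := by linarith
        calc _ = (t₁ + t₂) * (t₂ / (t₁ + t₂) * unitCost α (f u v + -t₁ * z u v)
              + t₁ / (t₁ + t₂) * unitCost α (f u v + t₂ * z u v)) := by field_simp
          _ ≤ _ := mul_le_mul_of_nonneg_left hc hd.le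
    rcases le_or_gt (flowCost α V fun u v => f u v + -t₁ * z u v) (flowCost α V f) with h | h
    · exact ⟨-t₁, h, hcard _ hv₁⟩
    · refine ⟨t₂, ?_, hcard _ hv₂⟩
      by_contra! h'
      nlinarith
  · push Not at hopp
    refine ⟨-t₁, ?_, hcard _ hv₁⟩
    unfold flowCost
    gcongr with u _ v _
    rcases le_or_gt (f u v) 0 with h | h
    · rw [unitCost_of_nonpos h, unitCost_of_nonpos (hneg _ hs₁ u v h)]
    · apply unitCost_mono hα0
      nlinarith [hopp u v h]

lemma exists_smaller_support {α : ℝ} (hα0 : 0 ≤ α) (hα1 : α ≤ 1) {V : Finset (Pt m)}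
    {f z : Pt m → Pt m → ℝ} (hf : IsFlow V f) (hz : IsFlow V z)
    (hzf : ∀ u v, f u v = 0 → z u v = 0) (hz0 : ∃ u v, z u v ≠ 0) :
    ∃ t : ℝ, flowCost α V (fun u v => f u v + t * z u v) ≤ flowCost α V f ∧
      (flowSupport V fun u v => f u v + t * z u v).card < (flowSupport V f).card := by
  obtain ⟨u, v, hf0, hz0⟩ : ∃ u v, 0 < f u v ∧ z u v ≠ 0 := by
    obtain ⟨u, v, h⟩ := hz0
    rcases lt_or_gt_of_ne fun h' => h (hzf u v h') with h' | h'
    · exact ⟨v, u, by rw [hf.anti u v]; linarith, by rwa [hz.anti u v, neg_ne_zero]⟩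
    · exact ⟨u, v, h', h⟩
  rcases lt_or_gt_of_ne hz0 with h | h
  · have hz' : IsFlow V fun u v => -z u v :=
      ⟨fun u v => by rw [hz.anti], fun u v h => hz.supp u v (neg_ne_zero.1 h)⟩
    obtain ⟨t, ht⟩ := exists_smaller_support_of_pos hα0 hα1 hf hz'
      (fun u v h => by rw [hzf u v h, neg_zero]) ⟨u, v, hf0, neg_pos.2 h⟩
    refine ⟨-t, ?_⟩
    simpa only [neg_mul, mul_neg] using ht
  · exact exists_smaller_support_of_pos hα0 hα1 hf hz hzf ⟨u, v, hf0, h⟩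

/-- Every net flow can be replaced by one with acyclic support, without increasing the cost. -/
lemma exists_acyclic_flow {α : ℝ} (hα0 : 0 ≤ α) (hα1 : α ≤ 1) {V : Finset (Pt m)}
    {f : Pt m → Pt m → ℝ} (hf : IsFlow V f) :
    ∃ g, IsFlow V g ∧ (∀ u, flowDiv V g u = flowDiv V f u) ∧ (flowGraph g).IsAcyclic ∧
      flowCost α V g ≤ flowCost α V f := by
  induction hN : (flowSupport V f).card using Nat.strong_induction_on generalizing f with
  | _ N ih =>
  by_cases hac : (flowGraph f).IsAcyclic
  · exact ⟨f, hf, fun _ => rfl, hac, le_rfl⟩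
  rw [SimpleGraph.isAcyclic_iff_forall_adj_isBridge] at hac
  push Not at hac
  obtain ⟨a, b, hab, hbridge⟩ := hac
  rw [SimpleGraph.isBridge_iff, not_not] at hbridge
  have hfab := hf.adj_iff.1 hab
  have ha := hf.supp a b hfab
  have hb := hf.right_mem hfab
  have hle : ∀ u v, ((flowGraph f).deleteEdges {s(a, b)}).Adj u v → f u v ≠ 0 :=
    fun u v h => hf.adj_iff.1 (SimpleGraph.deleteEdges_adj.1 h).1
  obtain ⟨z, hz, hzH, hzd⟩ := exists_unit_flow (fun u v h => hf.supp u v (hle u v h)) hbridge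
  have hz' := hz.add_smul (isFlow_segFlow ha hb) (-1)
  have hzab : z a b = 0 := by
    by_contra h
    exact (SimpleGraph.deleteEdges_adj.1 (hzH a b h)).2 rfl
  obtain ⟨t, htc, htN⟩ := exists_smaller_support hα0 hα1 hf hz' (fun u v h => by
      have h1 : z u v = 0 := by_contra fun h' => hle u v (hzH u v h') h
      have h2 : ¬(u = a ∧ v = b) := fun e => hfab (by rw [← e.1, ← e.2, h])
      have h3 : ¬(v = a ∧ u = b) := fun e => hfab (by rw [← e.1, ← e.2, hf.anti u v, h, neg_zero])
      simp [h1, segFlow, h2, h3])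
    ⟨a, b, by simp [hzab, segFlow, hab.ne.symm]⟩
  obtain ⟨g, hg, hgd, hga, hgc⟩ := ih _ (hN ▸ htN) (hf.add_smul hz' t) rfl
  refine ⟨g, hg, fun u => ?_, hga, hgc.trans htc⟩
  rw [hgd, flowDiv_add_smul, flowDiv_add_smul, hzd, flowDiv_segFlow ha hb]
  ring

/-- On acyclic support with the single source `x`, the flow reaching `y` runs along one path whose
edges all carry at least the amount `ε` consumed at `y` and at most the total mass `M + ε`.
Withdrawing that consumption saves at least the cost increment from `M` to `M + ε` along it. -/
lemma exists_withdraw_flow {α : ℝ} (hα0 : 0 ≤ α) (hα1 : α ≤ 1) {V : Finset (Pt m)}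
    {f : Pt m → Pt m → ℝ} (hf : IsFlow V f) (hac : (flowGraph f).IsAcyclic) {x y : Pt m}
    (hx : x ∈ V) (hy : y ∈ V) {M ε : ℝ} (hε : 0 < ε) {b : Pt m → ℝ} (hb : ∀ u, 0 ≤ b u)
    (hd : ∀ u, flowDiv V f u = (if u = x then M + ε else 0) - (b u + if u = y then ε else 0)) :
    ∃ g, IsFlow V g ∧ (∀ u, flowDiv V g u = (if u = x then M else 0) - b u) ∧
      flowCost α V g + (unitCost α (M + ε) - unitCost α M) * dist x y ≤ flowCost α V f := by
  have hB0 : ∀ C : Set (Pt m), 0 ≤ ∑ u ∈ V with u ∈ C, b u := fun C =>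
    Finset.sum_nonneg fun u _ => hb u
  have hite : ∀ (C : Set (Pt m)) (p : Pt m) (c : ℝ), p ∈ V →
      ∑ u ∈ V with u ∈ C, (if u = p then c else 0) = if p ∈ C then c else 0 := by
    intro C p c hp
    simp [hp]
  have hdC : ∀ C : Set (Pt m), ∑ u ∈ V with u ∈ C, flowDiv V f u
      = (if x ∈ C then M + ε else 0) - (∑ u ∈ V with u ∈ C, b u + if y ∈ C then ε else 0) := by
    intro C
    simp only [hd, Finset.sum_sub_distrib, Finset.sum_add_distrib, hite C x _ hx, hite C y _ hy]
  have hBM : ∀ C : Set (Pt m), ∑ u ∈ V with u ∈ C, b u ≤ M := by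
    intro C
    have h1 := hdC Set.univ
    rw [hf.sum_flowDiv_eq_zero _ fun _ _ _ _ => Set.mem_univ _] at h1
    simp only [Set.mem_univ, if_true, Finset.filter_true] at h1
    have h2 : ∑ u ∈ V with u ∈ C, b u ≤ ∑ u ∈ V, b u :=
      Finset.sum_le_sum_of_subset_of_nonneg (Finset.filter_subset _ _) fun u _ _ => hb u
    linarith
  have hM : 0 ≤ M := (hB0 Set.univ).trans (hBM Set.univ)
  have hreach : (flowGraph f).Reachable x y := by
    set C : Set (Pt m) := {u | (flowGraph f).Reachable y u}
    have h1 := hdC C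
    rw [hf.sum_flowDiv_eq_zero C fun u v hu huv =>
      SimpleGraph.Reachable.trans hu (hf.adj_iff.2 huv).reachable] at h1
    have hyC : y ∈ C := SimpleGraph.Reachable.refl _
    by_contra h
    have hxC : x ∉ C := fun h' => h (SimpleGraph.Reachable.symm h')
    rw [if_neg hxC, if_pos hyC] at h1
    linarith [hB0 C]
  obtain ⟨z, hz, hzH, hzd⟩ := exists_unit_flow
    (fun u v h => hf.supp u v (hf.adj_iff.1 h)) hreach
  have hedge : ∀ u v, z u v = 0 ∨ (z u v = 1 ∧ ε ≤ f u v ∧ f u v ≤ M + ε) ∨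
      (z u v = -1 ∧ f u v ≤ -ε) := by
    intro u v
    by_cases h0 : z u v = 0
    · exact Or.inl h0
    have hadj := hzH u v h0
    have hu := hz.supp u v h0
    have hv := hz.right_mem h0
    have hbr := SimpleGraph.isAcyclic_iff_forall_adj_isBridge.1 hac hadj
    rw [SimpleGraph.isBridge_iff] at hbr
    set C : Set (Pt m) := {w | ((flowGraph f).deleteEdges {s(u, v)}).Reachable u w}
    have huC : u ∈ C := SimpleGraph.Reachable.refl _
    have hvC : v ∉ C := hbr
    have hcross : ∀ w w', w ∈ C → w' ∉ C → (flowGraph f).Adj w w' → w = u ∧ w' = v := by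
      intro w w' hw hw' hww
      by_cases he : s(w, w') = s(u, v)
      · rcases Sym2.eq_iff.1 he with h | h
        · exact h
        · exact absurd (h.1 ▸ hw) hvC
      · exact absurd (SimpleGraph.Reachable.trans hw
          (SimpleGraph.deleteEdges_adj.2 ⟨hww, he⟩).reachable) hw'
    have hfC := hf.sum_flowDiv_eq_of_cut C hu hv huC hvC
      fun w w' hw hw' h => hcross w w' hw hw' (hf.adj_iff.2 h)
    have hzC := hz.sum_flowDiv_eq_of_cut C hu hv huC hvC
      fun w w' hw hw' h => hcross w w' hw hw' (hzH _ _ h)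
    rw [hdC] at hfC
    simp only [hzd, Finset.sum_sub_distrib, hite C x _ hx, hite C y _ hy] at hzC
    have h1 := hB0 C
    have h2 := hBM C
    rw [← hfC, ← hzC]
    by_cases hxC : x ∈ C <;> by_cases hyC : y ∈ C <;> simp only [hxC, hyC, if_true, if_false]
    · exact Or.inl (sub_self _)
    · exact Or.inr (Or.inl ⟨sub_zero _, by linarith, by linarith⟩)
    · exact Or.inr (Or.inr ⟨zero_sub _, by linarith⟩)
    · exact Or.inl (sub_self _)
  have hK : 0 ≤ unitCost α (M + ε) - unitCost α M :=
    sub_nonneg.2 (unitCost_mono hα0 (by linarith))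
  refine ⟨_, hf.add_smul hz (-ε), fun u => ?_, ?_⟩
  · rw [flowDiv_add_smul, hd, hzd]
    split_ifs <;> ring
  · have hlen := mul_le_mul_of_nonneg_left (dist_le_sum_of_unit_flow hz hx hy hzd) hK
    refine (add_le_add_right hlen _).trans ?_
    simp only [flowCost, Finset.mul_sum, ← Finset.sum_add_distrib, ← mul_assoc, ← add_mul]
    gcongr with u _ v _
    rcases hedge u v with h | ⟨h, h1, h2⟩ | ⟨h, h1⟩ <;> rw [h]
    · simp
    · have := unitCost_increment_le (r := f u v - ε) (t := M) hα0 hα1 (by linarith)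
        (by linarith) hε
      rw [sub_add_cancel] at this
      rw [max_eq_left zero_le_one, show f u v + -ε * 1 = f u v - ε by ring]
      linarith
    · rw [unitCost_of_nonpos (by linarith : f u v ≤ 0),
        unitCost_of_nonpos (by linarith : f u v + -ε * -1 ≤ 0)]
      simp

/-- Every net flow with divergence `a - b` is at least as expensive as some transport path. -/
lemma exists_transportPath_of_flow {α : ℝ} (hα0 : 0 ≤ α) (hα1 : α ≤ 1) {X : Set (Pt m)}
    {V : Finset (Pt m)} (hVX : ↑V ⊆ X) {f : Pt m → Pt m → ℝ} (hf : IsFlow V f)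
    {a b : Pt m →₀ ℝ} (ha : a.support ⊆ V) (hb : b.support ⊆ V)
    (hd : ∀ u, flowDiv V f u = a u - b u) :
    ∃ G, IsTransportPath X G a b ∧ WDG.cost α G ≤ flowCost α V f := by
  obtain ⟨g, hg, hgd, hga, hgc⟩ := exists_acyclic_flow hα0 hα1 hf
  let G : WDG m := ⟨V, (V ×ˢ V).filter fun e => 0 < g e.1 e.2, fun e => g e.1 e.2⟩
  have hE : ∀ F : Pt m × Pt m → ℝ, ∑ e ∈ G.E, F e
      = ∑ u ∈ V, ∑ v ∈ V, if 0 < g u v then F (u, v) else 0 := fun F => by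
    rw [Finset.sum_filter, Finset.sum_product]
  have hcost : WDG.cost α G = flowCost α V g := by
    rw [WDG.cost, hE]
    refine Finset.sum_congr rfl fun u _ => Finset.sum_congr rfl fun v _ => ?_
    rcases le_or_gt (g u v) 0 with h | h
    · rw [if_neg h.not_gt, unitCost_of_nonpos h, zero_mul]
    · rw [if_pos h, unitCost_of_pos h]
  refine ⟨G, ⟨?_, hVX, fun z h => ha h, fun z h => hb h, ?_, fun v => ?_⟩, hcost ▸ hgc⟩
  · intro e he
    obtain ⟨hV, hpos⟩ := Finset.mem_filter.1 he
    obtain ⟨h1, h2⟩ := Finset.mem_product.1 hV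
    exact ⟨h1, h2, fun h => hpos.ne' (by rw [h, hg.self]), hpos⟩
  · refine hga.anti fun u v huv => ?_
    rw [WDG.undirected, SimpleGraph.fromRel_adj] at huv
    rw [hg.adj_iff]
    rcases huv.2 with h | h
    · exact (Finset.mem_filter.1 h).2.ne'
    · have h' := (Finset.mem_filter.1 h).2.ne'
      rwa [hg.anti u v, neg_ne_zero] at h'
  · rw [← hd, ← hgd]
    have hout : G.outflow v = ∑ u ∈ V, max (g v u) 0 := by
      rw [WDG.outflow, Finset.sum_filter, hE]
      by_cases hv : v ∈ V
      · rw [Finset.sum_eq_single v]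
        · refine Finset.sum_congr rfl fun u _ => ?_
          rcases le_or_gt (g v u) 0 with h | h
          · rw [if_neg h.not_gt, max_eq_right h]
          · rw [if_pos h, if_pos rfl, max_eq_left h.le]
        · intro u _ huv
          simp [huv]
        · exact fun h => absurd hv h
      · rw [Finset.sum_eq_zero, Finset.sum_eq_zero]
        · intro u _
          rw [show g v u = 0 from by_contra fun h => hv (hg.supp v u h), max_self]
        · intro u hu
          have : u ≠ v := fun h => hv (h ▸ hu)
          simp [this]
    have hin : G.inflow v = ∑ u ∈ V, max (g u v) 0 := by
      rw [WDG.inflow, Finset.sum_filter, hE]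
      refine Finset.sum_congr rfl fun u _ => ?_
      by_cases hv : v ∈ V
      · rw [Finset.sum_eq_single v]
        · rcases le_or_gt (g u v) 0 with h | h
          · rw [if_neg h.not_gt, max_eq_right h]
          · rw [if_pos h, if_pos rfl, max_eq_left h.le]
        · intro u _ huv
          simp [huv]
        · exact fun h => absurd hv h
      · rw [Finset.sum_eq_zero, show g u v = 0 from by_contra fun h => hv (hg.right_mem h),
          max_self]
        intro w hw
        have : w ≠ v := fun h => hv (h ▸ hw)
        simp [this]
    rw [hout, hin, ← Finset.sum_sub_distrib, flowDiv]
    refine Finset.sum_congr rfl fun u _ => ?_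
    rw [hg.anti v u, max_zero_sub_max_neg_zero_eq_self]

/-- The net flow of a transport path. -/
lemma exists_flow_of_transportPath {α : ℝ} (hα0 : 0 ≤ α) {X : Set (Pt m)} {G : WDG m}
    {a b : Pt m →₀ ℝ} (hG : IsTransportPath X G a b) {V : Finset (Pt m)} (hV : G.V ⊆ V) :
    ∃ f, IsFlow V f ∧ (∀ u, flowDiv V f u = a u - b u) ∧ (flowGraph f).IsAcyclic ∧
      flowCost α V f ≤ WDG.cost α G := by
  obtain ⟨hok, -, -, -, hac, hbal⟩ := hG
  let W : Pt m → Pt m → ℝ := fun u v => if (u, v) ∈ G.E then G.w (u, v) else 0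
  have hW0 : ∀ u v, 0 ≤ W u v := fun u v => by
    simp only [W]
    split_ifs with h
    · exact (hok _ h).2.2.2.le
    · exact le_rfl
  have hWE : ∀ u v, W u v ≠ 0 → (u, v) ∈ G.E := fun u v h => by
    by_contra h'
    exact h (if_neg h')
  have hE : ∀ F : Pt m × Pt m → ℝ, ∑ e ∈ G.E, F e
      = ∑ u ∈ V, ∑ v ∈ V, if (u, v) ∈ G.E then F (u, v) else 0 := fun F => by
    have hsub : G.E ⊆ V ×ˢ V := fun e he =>
      Finset.mem_product.2 ⟨hV (hok e he).1, hV (hok e he).2.1⟩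
    rw [← Finset.sum_product V V (fun e => if e ∈ G.E then F e else 0), ← Finset.sum_filter,
      Finset.filter_mem_eq_inter, Finset.inter_eq_right.2 hsub]
  have hf : IsFlow V fun u v => W u v - W v u := by
    refine ⟨fun u v => by ring, fun u v h => ?_⟩
    by_cases h1 : W u v = 0
    · exact hV (hok _ (hWE v u fun h2 => h (by rw [h1, h2, sub_zero]))).2.1
    · exact hV (hok _ (hWE u v h1)).1
  refine ⟨_, hf, fun u => ?_, hac.anti fun u v h => ?_, ?_⟩
  · rw [← hbal]
    simp only [flowDiv, Finset.sum_sub_distrib]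
    congr 1
    · symm
      rw [WDG.outflow, Finset.sum_filter, hE]
      by_cases hu : u ∈ V
      · rw [Finset.sum_eq_single u]
        · simp [W]
        · intro v _ hvu
          simp [hvu]
        · exact fun h => absurd hu h
      · rw [Finset.sum_eq_zero, Finset.sum_eq_zero]
        · intro v _
          by_contra h
          exact hu (hV (hok _ (hWE u v h)).1)
        · intro v hv
          have : v ≠ u := fun h => hu (h ▸ hv)
          simp [this]
    · rw [WDG.inflow, Finset.sum_filter, hE]
      refine Finset.sum_congr rfl fun v _ => ?_
      by_cases hu : u ∈ V
      · rw [Finset.sum_eq_single u]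
        · simp [W]
        · intro w _ hwu
          simp [hwu]
        · exact fun h => absurd hu h
      · rw [Finset.sum_eq_zero]
        · by_contra h
          exact hu (hV (hok _ (hWE v u h)).2.1)
        · intro w hw
          have : w ≠ u := fun h => hu (h ▸ hw)
          simp [this]
  · have huv := hf.adj_iff.1 h
    rw [WDG.undirected, SimpleGraph.fromRel_adj]
    refine ⟨h.ne, ?_⟩
    by_cases h1 : W u v = 0
    · exact Or.inr (hWE v u fun h2 => huv (by rw [h1, h2, sub_zero]))
    · exact Or.inl (hWE u v h1)
  · rw [WDG.cost, hE, flowCost]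
    refine Finset.sum_le_sum fun u _ => Finset.sum_le_sum fun v _ => ?_
    split_ifs with h
    · rw [← unitCost_of_pos (hok _ h).2.2.2]
      refine mul_le_mul_of_nonneg_right (unitCost_mono hα0 ?_) dist_nonneg
      have h1 : W u v = G.w (u, v) := if_pos h
      linarith [hW0 v u]
    · have h1 : W u v = 0 := if_neg h
      rw [unitCost_of_nonpos (by linarith [hW0 v u]), zero_mul]

/-- Serving an additional demand `ε` at `y` costs at most a direct edge from the source. -/
lemma exists_transportPath_add {α : ℝ} (hα0 : 0 ≤ α) (hα1 : α ≤ 1) {X : Set (Pt m)}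
    {x y : Pt m} (hx : x ∈ X) (hy : y ∈ X) {M ε : ℝ} (hε : 0 < ε) {b : Pt m →₀ ℝ} {G : WDG m}
    (hG : IsTransportPath X G (Finsupp.single x M) b) :
    ∃ G', IsTransportPath X G' (Finsupp.single x (M + ε)) (b + Finsupp.single y ε) ∧
      WDG.cost α G' ≤ WDG.cost α G + ε ^ α * dist x y := by
  set V : Finset (Pt m) := insert x (insert y G.V) with hVdef
  have hxV : x ∈ V := by simp [hVdef]
  have hyV : y ∈ V := by simp [hVdef]
  have hGV : G.V ⊆ V := fun u hu => by simp [hVdef, hu]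
  have hVX : ↑V ⊆ X := by
    intro u hu
    rcases Finset.mem_insert.1 hu with rfl | hu
    · exact hx
    rcases Finset.mem_insert.1 hu with rfl | hu
    · exact hy
    · exact hG.2.1 hu
  obtain ⟨f, hf, hfd, -, hfc⟩ := exists_flow_of_transportPath hα0 hG hGV
  have hbV : (b + Finsupp.single y ε).support ⊆ V := by
    refine Finsupp.support_add.trans (Finset.union_subset ?_ ?_)
    · exact fun u hu => hGV (hG.2.2.2.1 u hu)
    · exact Finsupp.support_single_subset.trans (Finset.singleton_subset_iff.2 hyV)
  obtain ⟨G', hG', hc⟩ := exists_transportPath_of_flow (X := X) hα0 hα1 hVX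
    (hf.add_smul (isFlow_segFlow hxV hyV) ε) (a := Finsupp.single x (M + ε))
    (Finsupp.support_single_subset.trans (Finset.singleton_subset_iff.2 hxV)) hbV fun u => by
      rw [flowDiv_add_smul, hfd, flowDiv_segFlow hxV hyV]
      simp only [Finsupp.add_apply, Finsupp.single_apply, eq_comm (a := u)]
      split_ifs <;> ring
  refine ⟨G', hG', hc.trans ((flowCost_le_add hα0 hα1 _ _ _ _).trans ?_)⟩
  exact add_le_add hfc (flowCost_segFlow_le hε _ _ _)

/-- Withdrawing a demand `ε` at `y` saves at least the cost increment of the total mass along the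
distance to the source. -/
lemma exists_transportPath_withdraw {α : ℝ} (hα0 : 0 ≤ α) (hα1 : α ≤ 1) {X : Set (Pt m)}
    {x y : Pt m} (hx : x ∈ X) {M ε : ℝ} (hε : 0 < ε) {b : Pt m →₀ ℝ} (hb : ∀ u, 0 ≤ b u)
    {G : WDG m}
    (hG : IsTransportPath X G (Finsupp.single x (M + ε)) (b + Finsupp.single y ε)) :
    ∃ G', IsTransportPath X G' (Finsupp.single x M) b ∧
      WDG.cost α G' + (unitCost α (M + ε) - unitCost α M) * dist x y ≤ WDG.cost α G := by
  set V : Finset (Pt m) := insert x G.V with hVdef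
  have hxV : x ∈ V := by simp [hVdef]
  have hGV : G.V ⊆ V := fun u hu => by simp [hVdef, hu]
  have hbsupp : ∀ u, 0 < b u + Finsupp.single y ε u → u ∈ V := fun u hu =>
    hGV (hG.2.2.2.1 u (Finsupp.mem_support_iff.2 hu.ne'))
  have hyV : y ∈ V := hbsupp y (by rw [Finsupp.single_eq_same]; linarith [hb y])
  have hbV : b.support ⊆ V := fun u hu => hbsupp u <| by
    have h1 : 0 < b u := (hb u).lt_of_ne' (Finsupp.mem_support_iff.1 hu)
    have h2 : 0 ≤ Finsupp.single y ε u := by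
      rw [Finsupp.single_apply]
      split_ifs
      · exact hε.le
      · exact le_rfl
    linarith
  have hVX : ↑V ⊆ X := by
    intro u hu
    rcases Finset.mem_insert.1 hu with rfl | hu
    · exact hx
    · exact hG.2.1 hu
  obtain ⟨f, hf, hfd, hac, hfc⟩ := exists_flow_of_transportPath hα0 hG hGV
  obtain ⟨g, hg, hgd, hgc⟩ := exists_withdraw_flow (M := M) (b := b) hα0 hα1 hf hac hxV hyV hε hb
    fun u => by simp only [hfd, Finsupp.add_apply, Finsupp.single_apply, eq_comm (a := u)]
  obtain ⟨G', hG', hc⟩ := exists_transportPath_of_flow (X := X) (a := Finsupp.single x M)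
    hα0 hα1 hVX hg (Finsupp.support_single_subset.trans (Finset.singleton_subset_iff.2 hxV)) hbV
    fun u => by simp only [hgd, Finsupp.single_apply, eq_comm (a := u)]
  exact ⟨G', hG', by linarith⟩

end NetFlow

section Cost

variable {m : ℕ}

lemma dCost_le_cost {X : Set (Pt m)} {α : ℝ} {a b : Pt m →₀ ℝ} {G : WDG m}
    (hG : IsTransportPath X G a b) : dCost X α a b ≤ WDG.cost α G := by
  refine csInf_le ⟨0, ?_⟩ ⟨G, hG, rfl⟩
  rintro _ ⟨G', hG', rfl⟩
  exact Finset.sum_nonneg fun e he =>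
    mul_nonneg (Real.rpow_nonneg (hG'.1 e he).2.2.2.le _) dist_nonneg

lemma dCost_add_le {α : ℝ} (hα0 : 0 ≤ α) (hα1 : α ≤ 1) {X : Set (Pt m)} {x y : Pt m}
    (hx : x ∈ X) (hy : y ∈ X) {M ε : ℝ} (hε : 0 < ε) {b : Pt m →₀ ℝ}
    (hne : ∃ G, IsTransportPath X G (Finsupp.single x M) b) :
    dCost X α (Finsupp.single x (M + ε)) (b + Finsupp.single y ε)
      ≤ dCost X α (Finsupp.single x M) b + ε ^ α * dist x y := by
  rw [← sub_le_iff_le_add]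
  refine le_csInf (Set.Nonempty.image _ hne) ?_
  rintro _ ⟨G, hG, rfl⟩
  obtain ⟨G', hG', hc⟩ := exists_transportPath_add hα0 hα1 hx hy hε hG
  linarith [dCost_le_cost (α := α) hG']

lemma dCost_withdraw_le {α : ℝ} (hα0 : 0 ≤ α) (hα1 : α ≤ 1) {X : Set (Pt m)} {x y : Pt m}
    (hx : x ∈ X) {M ε : ℝ} (hε : 0 < ε) {b : Pt m →₀ ℝ} (hb : ∀ u, 0 ≤ b u)
    (hne : ∃ G, IsTransportPath X G (Finsupp.single x (M + ε)) (b + Finsupp.single y ε)) :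
    dCost X α (Finsupp.single x M) b + (unitCost α (M + ε) - unitCost α M) * dist x y
      ≤ dCost X α (Finsupp.single x (M + ε)) (b + Finsupp.single y ε) := by
  refine le_csInf (Set.Nonempty.image _ hne) ?_
  rintro _ ⟨G, hG, rfl⟩
  obtain ⟨G', hG', hc⟩ := exists_transportPath_withdraw hα0 hα1 hx hε hb hG
  linarith [dCost_le_cost (α := α) hG']

lemma exists_transportPath_single_sum {ι : Type*} {X : Set (Pt m)} {x : Pt m} (hx : x ∈ X)
    {y : ι → Pt m} (hy : ∀ j, y j ∈ X) {n : ι → ℝ} (hn : ∀ j, 0 < n j) (F : Finset ι) :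
    ∃ G, IsTransportPath X G (Finsupp.single x (∑ j ∈ F, n j))
      (∑ j ∈ F, Finsupp.single (y j) (n j)) := by
  induction F using Finset.induction_on with
  | empty =>
    obtain ⟨G, hG, -⟩ := exists_transportPath_of_flow (α := 0) (X := X) (V := ∅)
      (f := fun _ _ => 0) (a := 0) (b := 0) le_rfl zero_le_one (by simp) ⟨by simp, by simp⟩
      (by simp) (by simp) (by simp [flowDiv])
    exact ⟨G, by simpa using hG⟩
  | insert j F hj ih =>
    obtain ⟨G, hG⟩ := ih
    obtain ⟨G', hG', -⟩ := exists_transportPath_add (α := 0) le_rfl zero_le_one hx (hy j) (hn j) hG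
    refine ⟨G', ?_⟩
    rwa [Finset.sum_insert hj, Finset.sum_insert hj, add_comm (n j), add_comm (Finsupp.single _ _)]

end Cost

/-- If for every `i ≠ s` with `m(b_i) ≥ n_j` one has
`‖y_j − x_s‖ < ρ_α(m(b_i), n_j) ‖y_j − x_i‖`, then the optimal assignment map
sends `j` to `s`. -/
theorem stmt_10 {m k ℓ : ℕ} (X : Set (Pt m)) (hXc : IsCompact X) (hXconv : Convex ℝ X)
    (α : ℝ) (hα0 : 0 ≤ α) (hα1 : α < 1)
    (x : Fin k → Pt m) (hxinj : Function.Injective x) (hxX : ∀ i, x i ∈ X)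
    (y : Fin ℓ → Pt m) (hyinj : Function.Injective y) (hyX : ∀ j, y j ∈ X)
    (n : Fin ℓ → ℝ) (hn : ∀ j, 0 < n j) (hnsum : ∑ j, n j = 1)
    (hk : 2 ≤ k) (S : Fin ℓ → Fin k) (hS : IsOptimalAssign X α x y n S)
    (j : Fin ℓ) (s : Fin k)
    (hyp : ∀ i : Fin k, i ≠ s → n j ≤ mB n S i →
      ‖y j - x s‖ < rho α (mB n S i) (n j) * ‖y j - x i‖) :
    S j = s := by
  by_contra hne
  set i := S j with hi
  set S' := Function.update S j s with hS'
  have hfi : Finset.univ.filter (S · = i) = insert j (Finset.univ.filter (S' · = i)) := by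
    ext t
    by_cases ht : t = j
    · simp [ht, ← hi]
    · simp [hS', ht]
  have hfs : Finset.univ.filter (S' · = s) = insert j (Finset.univ.filter (S · = s)) := by
    ext t
    by_cases ht : t = j
    · simp [hS', ht]
    · simp [hS', ht]
  have hji : j ∉ Finset.univ.filter (S' · = i) := by simp [hS', Ne.symm hne]
  have hjs : j ∉ Finset.univ.filter (S · = s) := by simp [← hi, hne]
  have hmi : mB n S i = mB n S' i + n j := by
    rw [mB, hfi, Finset.sum_insert hji, add_comm, mB]
  have hbi : bPart y n S i = bPart y n S' i + Finsupp.single (y j) (n j) := by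
    rw [bPart, hfi, Finset.sum_insert hji, add_comm, bPart]
  have hms : mB n S' s = mB n S s + n j := by
    rw [mB, hfs, Finset.sum_insert hjs, add_comm, mB]
  have hbs : bPart y n S' s = bPart y n S s + Finsupp.single (y j) (n j) := by
    rw [bPart, hfs, Finset.sum_insert hjs, add_comm, bPart]
  have hother : ∀ r, r ≠ i → r ≠ s →
      Finset.univ.filter (S' · = r) = Finset.univ.filter (S · = r) := by
    intro r hri hrs
    ext t
    by_cases ht : t = j
    · simp [hS', ht, ← hi, Ne.symm hri, Ne.symm hrs]
    · simp [hS', ht]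
  have hM : 0 ≤ mB n S' i := Finset.sum_nonneg fun t _ => (hn t).le
  have hb : ∀ u, 0 ≤ bPart y n S' i u := fun u => by
    rw [bPart, Finsupp.finsetSum_apply]
    refine Finset.sum_nonneg fun t _ => ?_
    rw [Finsupp.single_apply]
    split_ifs
    · exact (hn t).le
    · exact le_rfl
  have hstar : ∀ (T : Fin ℓ → Fin k) (r : Fin k), ∃ G,
      IsTransportPath X G (Finsupp.single (x r) (mB n T r)) (bPart y n T r) := fun T r =>
    exists_transportPath_single_sum (hxX r) hyX hn _
  have hwithdraw := dCost_withdraw_le (y := y j) hα0 hα1.le (hxX i) (hn j) hb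
    (by rw [← hmi, ← hbi]; exact hstar S i)
  have hadd := dCost_add_le hα0 hα1.le (hxX s) (hyX j) (hn j) (hstar S s)
  rw [← hmi, ← hbi] at hwithdraw
  rw [← hms, ← hbs] at hadd
  have hlt := mul_lt_mul_of_pos_left (hyp i hne (by linarith))
    (Real.rpow_pos_of_pos (hn j) α)
  rw [← mul_assoc, hmi, rpow_mul_rho hM (hn j), ← hmi, ← dist_eq_norm, ← dist_eq_norm,
    dist_comm, dist_comm (y j)] at hlt
  have hE := hS S'
  have hsum : ∀ D : Fin k → ℝ, ∑ r, D r
      = D i + (D s + ∑ r ∈ (Finset.univ.erase i).erase s, D r) := fun D => by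
    rw [Finset.add_sum_erase _ D (Finset.mem_erase.2 ⟨Ne.symm hne, Finset.mem_univ s⟩),
      Finset.add_sum_erase _ D (Finset.mem_univ i)]
  have hrest : ∑ r ∈ (Finset.univ.erase i).erase s,
        dCost X α (Finsupp.single (x r) (mB n S' r)) (bPart y n S' r)
      = ∑ r ∈ (Finset.univ.erase i).erase s,
        dCost X α (Finsupp.single (x r) (mB n S r)) (bPart y n S r) := by
    refine Finset.sum_congr rfl fun r hr => ?_
    have hrs := (Finset.mem_erase.1 hr).1
    have hri := (Finset.mem_erase.1 (Finset.mem_erase.1 hr).2).1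
    simp only [mB, bPart, hother r hri hrs]
  rw [Ealpha, Ealpha, hsum, hsum, hrest] at hE
  linarith

end
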